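/- arXiv:2105.08686 — 2 statements merged into one kernel-verified Lean document; each statement's English description precedes it below -/
import Mathlib

section
/- Let α > 0 and a₂, β₁, β₂ > 0. The Kullback–Leibler divergence of the gamma distribution with shape a₁ = α and rate β₁ from the gamma distribution with shape a₂ and rate β₂ equals (α − a₂)·ψ(α) − log Γ(α) + log Γ(a₂) + a₂·log(β₁/β₂) + α·(β₂ − β₁)/β₁, where ψ denotes the digamma function. -/
open MeasureTheory Real

/-- The digamma function `ψ(α) = d/dα log Γ(α)`. -/
noncomputable def digamma (x : ℝ) : ℝ := deriv (fun y : ℝ => Real.log (Real.Gamma y)) x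

/-- The Lebesgue density of the gamma distribution with shape `a > 0` and rate `b > 0`
on `(0, ∞)`. -/
noncomputable def gammaDensity (a b x : ℝ) : ℝ :=
  b ^ a * x ^ (a - 1) * Real.exp (-(b * x)) / Real.Gamma a

theorem aux_log (a r : ℝ) (ha : 0 < a) (hr : 0 < r) :
    IntegrableOn (fun t : ℝ => t ^ (a - 1) * Real.exp (-(r * t)) * Real.log t) (Set.Ioi 0) ∧
    ∫ t in Set.Ioi (0 : ℝ), t ^ (a - 1) * Real.exp (-(r * t)) * Real.log t
      = (1 / r) ^ a * Real.Gamma a * (digamma a - Real.log r) := by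
  have key := mellin_hasDerivAt_of_isBigO_rpow (E := ℂ) (a := a + 1) (b := 0) (s := (a : ℂ))
    (f := fun t : ℝ => ((Real.exp (-(r * t)) : ℝ) : ℂ))
    ((Continuous.continuousOn (by fun_prop)).locallyIntegrableOn measurableSet_Ioi)
    (by
      rw [← Asymptotics.isBigO_norm_left]
      simp_rw [Complex.norm_real, Asymptotics.isBigO_norm_left]
      simpa only [neg_mul] using (isLittleO_exp_neg_mul_rpow_atTop hr _).isBigO)
    (by simp)
    (by
      simp_rw [neg_zero, Real.rpow_zero]
      refine Asymptotics.isBigO_const_of_tendsto (?_ : Filter.Tendsto _ _ (nhds (1 : ℂ))) one_ne_zero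
      rw [(by simp : (1 : ℂ) = (Real.exp (-(r * 0)) : ℝ))]
      exact (Continuous.continuousWithinAt (by fun_prop)))
    (by simpa using ha)
  have e1 : ∀ t ∈ Set.Ioi (0 : ℝ), ((t : ℂ) ^ ((a : ℂ) - 1) •
      (Real.log t • ((Real.exp (-(r * t)) : ℝ) : ℂ))) =
      ((t ^ (a - 1) * Real.exp (-(r * t)) * Real.log t : ℝ) : ℂ) := by
    intro t ht
    rw [show ((a : ℂ) - 1) = ((a - 1 : ℝ) : ℂ) by push_cast; rfl,
      ← Complex.ofReal_cpow (le_of_lt ht), smul_eq_mul, Complex.real_smul]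
    push_cast
    ring
  have hint : IntegrableOn (fun t : ℝ => t ^ (a - 1) * Real.exp (-(r * t)) * Real.log t)
      (Set.Ioi 0) := by
    have h := (integrableOn_congr_fun e1 measurableSet_Ioi).1 key.1
    exact Integrable.re h
  refine ⟨hint, ?_⟩
  have hD := key.2.real_of_complex
  have hJ : mellin (fun t : ℝ => Real.log t • ((Real.exp (-(r * t)) : ℝ) : ℂ)) (a : ℂ) =
      ((∫ t in Set.Ioi (0 : ℝ), t ^ (a - 1) * Real.exp (-(r * t)) * Real.log t : ℝ) : ℂ) := by
    rw [mellin, setIntegral_congr_fun measurableSet_Ioi e1]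
    exact integral_ofReal
  rw [hJ, Complex.ofReal_re] at hD
  have hg : (fun x : ℝ => (mellin (fun t : ℝ => ((Real.exp (-(r * t)) : ℝ) : ℂ)) (x : ℂ)).re)
      =ᶠ[nhds a] fun x => (1 / r) ^ x * Real.Gamma x := by
    filter_upwards [lt_mem_nhds ha] with x hx
    rw [← Real.integral_rpow_mul_exp_neg_mul_Ioi hx hr, mellin]
    have e2 : ∀ t ∈ Set.Ioi (0 : ℝ), ((t : ℂ) ^ ((x : ℂ) - 1) •
        ((Real.exp (-(r * t)) : ℝ) : ℂ)) =
        ((t ^ (x - 1) * Real.exp (-(r * t)) : ℝ) : ℂ) := by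
      intro t ht
      rw [show ((x : ℂ) - 1) = ((x - 1 : ℝ) : ℂ) by push_cast; rfl,
        ← Complex.ofReal_cpow (le_of_lt ht), smul_eq_mul]
      push_cast
      ring
    rw [setIntegral_congr_fun measurableSet_Ioi e2]
    have := integral_ofReal (𝕜 := ℂ) (μ := volume.restrict (Set.Ioi 0))
      (f := fun t : ℝ => t ^ (x - 1) * Real.exp (-(r * t)))
    exact (congrArg Complex.re this).trans (Complex.ofReal_re _)
  have hD' := hD.congr_of_eventuallyEq hg.symm
  have hΓ : DifferentiableAt ℝ Real.Gamma a := Real.differentiableAt_Gamma (by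
    intro m hm
    have : (0 : ℝ) ≤ m := Nat.cast_nonneg m
    linarith)
  have hpos := Real.Gamma_pos_of_pos ha
  have h2 := ((hasDerivAt_id a).const_rpow (a := 1 / r) (by positivity)).mul hΓ.hasDerivAt
  have h3 := hD'.unique h2
  have hdig : digamma a = deriv Real.Gamma a / Real.Gamma a :=
    (hΓ.hasDerivAt.log hpos.ne').deriv
  rw [h3, hdig]
  simp only [id, one_div, Real.log_inv]
  field_simp
  ring

/-- The Kullback–Leibler divergence of `Gamma(α, β₁)` from `Gamma(a₂, β₂)` equals
`(α − a₂)ψ(α) − log Γ(α) + log Γ(a₂) + a₂ log(β₁/β₂) + α(β₂ − β₁)/β₁`. -/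
theorem kl_gamma_gamma (α a₂ β₁ β₂ : ℝ) (hα : 0 < α) (ha₂ : 0 < a₂)
    (hβ₁ : 0 < β₁) (hβ₂ : 0 < β₂) :
    (∫ x in Set.Ioi (0 : ℝ),
        gammaDensity α β₁ x * Real.log (gammaDensity α β₁ x / gammaDensity a₂ β₂ x))
      = (α - a₂) * digamma α - Real.log (Real.Gamma α) + Real.log (Real.Gamma a₂)
        + a₂ * Real.log (β₁ / β₂) + α * (β₂ - β₁) / β₁ := by
  have hΓ₁ := Real.Gamma_pos_of_pos hα
  have hΓ₂ := Real.Gamma_pos_of_pos ha₂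
  obtain ⟨hi1, hI1⟩ := aux_log α β₁ hα hβ₁
  have hI0 := Real.integral_rpow_mul_exp_neg_mul_Ioi hα hβ₁
  have hI2 := Real.integral_rpow_mul_exp_neg_mul_Ioi (a := α + 1) (by linarith) hβ₁
  have hi0 : IntegrableOn (fun t : ℝ => t ^ (α - 1) * Real.exp (-(β₁ * t))) (Set.Ioi 0) :=
    .of_integral_ne_zero (by rw [hI0]; positivity)
  have hi2 : IntegrableOn (fun t : ℝ => t ^ (α + 1 - 1) * Real.exp (-(β₁ * t))) (Set.Ioi 0) :=
    .of_integral_ne_zero (by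
      rw [hI2]
      have := Real.Gamma_pos_of_pos (show 0 < α + 1 by linarith)
      positivity)
  set C := β₁ ^ α / Real.Gamma α with hC
  set K := α * Real.log β₁ - a₂ * Real.log β₂ - Real.log (Real.Gamma α)
    + Real.log (Real.Gamma a₂) with hK
  have e : ∀ x ∈ Set.Ioi (0 : ℝ),
      gammaDensity α β₁ x * Real.log (gammaDensity α β₁ x / gammaDensity a₂ β₂ x) =
      C * K * (x ^ (α - 1) * Real.exp (-(β₁ * x)))
      + C * (α - a₂) * (x ^ (α - 1) * Real.exp (-(β₁ * x)) * Real.log x)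
      + C * (β₂ - β₁) * (x ^ (α + 1 - 1) * Real.exp (-(β₁ * x))) := by
    intro x hx
    have hx : 0 < x := hx
    have hl : ∀ a b : ℝ, 0 < a → 0 < b → Real.log (gammaDensity a b x) =
        a * Real.log b + (a - 1) * Real.log x - b * x - Real.log (Real.Gamma a) := by
      intro a b ha hb
      have := Real.Gamma_pos_of_pos ha
      have h1 := Real.rpow_pos_of_pos hb a
      have h2 := Real.rpow_pos_of_pos hx (a - 1)
      rw [gammaDensity, Real.log_div (by positivity) this.ne',
        Real.log_mul (by positivity) (by positivity), Real.log_mul h1.ne' h2.ne',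
        Real.log_rpow hb, Real.log_rpow hx, Real.log_exp]
      ring
    have hp : ∀ a b : ℝ, 0 < a → 0 < b → gammaDensity a b x ≠ 0 := by
      intro a b ha hb
      have := Real.Gamma_pos_of_pos ha
      unfold gammaDensity
      positivity
    rw [Real.log_div (hp _ _ hα hβ₁) (hp _ _ ha₂ hβ₂), hl _ _ hα hβ₁, hl _ _ ha₂ hβ₂]
    have hx1 : x ^ (α + 1 - 1) = x ^ (α - 1) * x := by
      rw [← Real.rpow_add_one hx.ne']
      congr 1
      ring
    rw [hx1, gammaDensity, hC, hK]
    ring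
  have hs : IntegrableOn (fun x : ℝ => C * K * (x ^ (α - 1) * Real.exp (-(β₁ * x)))
      + C * (α - a₂) * (x ^ (α - 1) * Real.exp (-(β₁ * x)) * Real.log x)) (Set.Ioi 0) :=
    Integrable.add (hi0.const_mul _) (hi1.const_mul _)
  rw [setIntegral_congr_fun measurableSet_Ioi e,
    integral_add hs (hi2.const_mul _),
    integral_add (hi0.const_mul _) (hi1.const_mul _),
    integral_const_mul, integral_const_mul, integral_const_mul, hI0, hI1, hI2,
    Real.Gamma_add_one hα.ne', Real.rpow_add_one (by positivity), one_div,
    Real.inv_rpow hβ₁.le, Real.log_div hβ₁.ne' hβ₂.ne', hC, hK]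
  have := Real.rpow_pos_of_pos hβ₁ α
  field_simp
  ring
end

section
/- For every α > 0, the quantity (α − 1)·ψ(α) − log Γ(α) is nonnegative, and it equals 0 if and only if α = 1. Consequently the PC-prior distance d(α) = √(2((α − 1)ψ(α) − log Γ(α))) is well defined for all α > 0 and vanishes exactly at the base model α = 1. -/
open Real

lemma strictConvexOn_logGamma :
    StrictConvexOn ℝ (Set.Ioi 0) (fun y : ℝ => Real.log (Real.Gamma y)) := by
  have h1 : ConvexOn ℝ (Set.Ioi 0) (fun y : ℝ => Real.log (Real.Gamma (y + 1))) := by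
    have h := Real.convexOn_log_Gamma.translate_left (1 : ℝ)
    refine (h.subset (s := Set.Ioi 0) ?_ (convex_Ioi 0)).congr ?_
    · intro x hx
      simp only [Set.mem_preimage, Set.mem_Ioi] at *
      linarith
    · intro x hx
      simp
  have h2 := h1.add_strictConvexOn strictConcaveOn_log_Ioi.neg
  refine h2.congr ?_
  intro x hx
  have hx : (0 : ℝ) < x := hx
  simp only [Pi.add_apply, Pi.neg_apply]
  rw [Real.Gamma_add_one hx.ne', Real.log_mul hx.ne' (Real.Gamma_pos_of_pos hx).ne']
  ring

lemma gap_pos (α : ℝ) (hα : 0 < α) (h : α ≠ 1) :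
    0 < (α - 1) * digamma α - Real.log (Real.Gamma α) := by
  have hd : HasDerivAt (fun y : ℝ => Real.log (Real.Gamma y)) (digamma α) α := by
    refine DifferentiableAt.hasDerivAt ?_
    refine DifferentiableAt.log (Real.differentiableAt_Gamma fun m => ?_)
      (Real.Gamma_pos_of_pos hα).ne'
    have : (0 : ℝ) ≤ m := m.cast_nonneg
    linarith
  have h1 : (1 : ℝ) ∈ Set.Ioi (0 : ℝ) := by simp
  rcases lt_or_gt_of_ne h with h | h
  · have := strictConvexOn_logGamma.lt_slope_of_hasDerivAt (Set.mem_Ioi.2 hα) h1 h hd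
    rw [slope_def_field, lt_div_iff₀ (by linarith)] at this
    simp only [Real.Gamma_one, Real.log_one] at this
    linarith
  · have := strictConvexOn_logGamma.slope_lt_of_hasDerivAt h1 (Set.mem_Ioi.2 hα) h hd
    rw [slope_def_field, div_lt_iff₀ (by linarith)] at this
    simp only [Real.Gamma_one, Real.log_one] at this
    linarith

/-- For every `α > 0`, `(α − 1)ψ(α) − log Γ(α) ≥ 0`, with equality iff `α = 1`;
consequently the PC-prior distance `d(α) = √(2((α − 1)ψ(α) − log Γ(α)))` is well defined
for all `α > 0` and vanishes exactly at the base model `α = 1`. -/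
theorem pcDistance_nonneg_eq_zero_iff (α : ℝ) (hα : 0 < α) :
    0 ≤ (α - 1) * digamma α - Real.log (Real.Gamma α)
    ∧ ((α - 1) * digamma α - Real.log (Real.Gamma α) = 0 ↔ α = 1)
    ∧ (Real.sqrt (2 * ((α - 1) * digamma α - Real.log (Real.Gamma α))) = 0 ↔ α = 1) := by
  rcases eq_or_ne α 1 with rfl | h
  · simp
  · have hp := gap_pos α hα h
    refine ⟨hp.le, iff_of_false hp.ne' h, iff_of_false ?_ h⟩
    exact (Real.sqrt_pos.2 (by linarith)).ne'
end
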